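/- arXiv:1404.1140 — 3 statements merged into one kernel-verified Lean document; each statement's English description precedes it below -/
import Mathlib

section
/- (Theorem 1, exact-expectation form.) For every joint action a ∈ A, the mixture-of-experts value equals the true value plus the sampling-policy-dependent bias: Q̂(a) = ∑_{e∈E} E_{a'∼π}[Q(a') | a'_e = a_e] = Q(a) + B_π(a), where B_π(a) = ∑_{e∈E} ∑_{e'∈E, e'≠e} ∑_{b̄ ∈ ∏_{i∈e'∖e} A_i} π(b̄ | a_e) · Q_{e'}(b̄, a_{e'∩e}). -/
open Finset

namespace FVPOMCP

variable {I : Type*} [Fintype I] [DecidableEq I]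
variable {A : I → Type*} [∀ i, Fintype (A i)] [∀ i, DecidableEq (A i)] [∀ i, Nonempty (A i)]

/-- Restriction of a joint action `a` to the agents in `s` (written `a_s`). -/
def restrict (s : Finset I) (a : ∀ i, A i) : ∀ i : s, A i.1 := fun i => a i.1

/-- The joint action agreeing with the local action `b` on `s` and with `a` elsewhere. -/
def patch (s : Finset I) (b : ∀ i : s, A i.1) (a : ∀ i, A i) : ∀ i, A i :=
  fun i => if h : i ∈ s then b ⟨i, h⟩ else a i

/-- The conditional probability `π(b | a_e)` that a random joint action `a' ∼ π`
restricts to `b` on `s`, given that it restricts to `a_e` on `e`. -/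
noncomputable def condProb (π : (∀ i, A i) → ℝ) (e : Finset I) (a : ∀ i, A i)
    (s : Finset I) (b : ∀ i : s, A i.1) : ℝ :=
  (∑ a' : ∀ i, A i, if restrict e a' = restrict e a ∧ restrict s a' = b then π a' else 0) /
    (∑ a' : ∀ i, A i, if restrict e a' = restrict e a then π a' else 0)

/-- The conditional expectation `E_{a'∼π}[f(a') | a'_e = a_e]`. -/
noncomputable def condExp (π : (∀ i, A i) → ℝ) (e : Finset I) (a : ∀ i, A i)
    (f : (∀ i, A i) → ℝ) : ℝ :=
  (∑ a' : ∀ i, A i, if restrict e a' = restrict e a then π a' * f a' else 0) /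
    (∑ a' : ∀ i, A i, if restrict e a' = restrict e a then π a' else 0)

/-- The marginal probability `π(b)` that a random joint action restricts to `b` on `s`. -/
def margProb (π : (∀ i, A i) → ℝ) (s : Finset I) (b : ∀ i : s, A i.1) : ℝ :=
  ∑ a' : ∀ i, A i, if restrict s a' = b then π a' else 0

/-- The bias term `B_π(a)`. -/
noncomputable def bias (E : Finset (Finset I)) (Qloc : (e : Finset I) → (∀ i : e, A i.1) → ℝ)
    (π : (∀ i, A i) → ℝ) (a : ∀ i, A i) : ℝ :=
  ∑ e ∈ E, ∑ e' ∈ E.erase e,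
    ∑ b : ∀ i : (e' \ e : Finset I), A i.1,
      condProb π e a (e' \ e) b * Qloc e' (restrict e' (patch (e' \ e) b a))


theorem sum_restrict_eq_pos {π : (∀ i, A i) → ℝ} (hπ : ∀ a, 0 < π a) (e : Finset I)
    (a : ∀ i, A i) : 0 < ∑ a' : ∀ i, A i, if restrict e a' = restrict e a then π a' else 0 := by
  refine Finset.sum_pos' (fun a' _ => ?_) ⟨a, Finset.mem_univ a, by simpa using hπ a⟩
  split_ifs
  · exact (hπ a').le
  · exact le_rfl

theorem condExp_sum {ι : Type*} (π : (∀ i, A i) → ℝ) (e : Finset I) (a : ∀ i, A i)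
    (s : Finset ι) (f : ι → (∀ i, A i) → ℝ) :
    condExp π e a (fun a' => ∑ j ∈ s, f j a') = ∑ j ∈ s, condExp π e a (f j) := by
  simp only [condExp]
  rw [← Finset.sum_div, Finset.sum_comm]
  congr 1
  refine Finset.sum_congr rfl fun a' _ => ?_
  split_ifs
  · exact Finset.mul_sum _ _ _
  · simp

/-- The conditional expectation of a function of `a'_e` given `a_e` is its value at `a_e`. -/
theorem condExp_comp_restrict_self {π : (∀ i, A i) → ℝ} (hπ : ∀ a, 0 < π a) (e : Finset I)
    (a : ∀ i, A i) (g : (∀ i : e, A i.1) → ℝ) :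
    condExp π e a (fun a' => g (restrict e a')) = g (restrict e a) := by
  rw [condExp, div_eq_iff (sum_restrict_eq_pos hπ e a).ne', Finset.mul_sum]
  refine Finset.sum_congr rfl fun a' _ => ?_
  split_ifs with h
  · rw [h, mul_comm]
  · simp

/-- If `f` is a function `g` of `a'_s` on the event `a'_e = a_e`, its conditional expectation
is the average of `g` against the conditional law of `a'_s`. -/
theorem condExp_eq_sum_condProb_mul (π : (∀ i, A i) → ℝ) (e : Finset I) (a : ∀ i, A i)
    (s : Finset I) (f : (∀ i, A i) → ℝ) (g : (∀ i : s, A i.1) → ℝ)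
    (hfg : ∀ a', restrict e a' = restrict e a → f a' = g (restrict s a')) :
    condExp π e a f = ∑ b : ∀ i : s, A i.1, condProb π e a s b * g b := by
  simp only [condExp, condProb, div_mul_eq_mul_div]
  rw [← Finset.sum_div]
  congr 1
  simp only [Finset.sum_mul]
  rw [Finset.sum_comm]
  refine Finset.sum_congr rfl fun a' _ => ?_
  by_cases h : restrict e a' = restrict e a
  · simp [h, hfg a' h, ite_mul]
  · simp [h]

theorem restrict_patch_sdiff {e : Finset I} {a a' : ∀ i, A i}
    (h : restrict e a' = restrict e a) (s : Finset I) :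
    restrict s (patch (s \ e) (restrict (s \ e) a') a) = restrict s a' := by
  funext ⟨i, hi⟩
  by_cases hie : i ∈ e
  · simpa [restrict, patch, hie] using (congrFun h ⟨i, hie⟩).symm
  · simp [restrict, patch, hi, hie]

/-- Theorem 1, exact-expectation form. For every joint action `a`,
the mixture-of-experts value `Q̂(a) = ∑_{e∈E} E_{a'∼π}[Q(a') | a'_e = a_e]` equals the
true value plus the sampling-policy-dependent bias: `Q̂(a) = Q(a) + B_π(a)`. -/
theorem mixture_of_experts_eq_value_add_bias
    {I : Type*} [Fintype I] [DecidableEq I]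
    {A : I → Type*} [∀ i, Fintype (A i)] [∀ i, DecidableEq (A i)] [∀ i, Nonempty (A i)]
    (E : Finset (Finset I)) (Qloc : (e : Finset I) → (∀ i : e, A i.1) → ℝ)
    (π : (∀ i, A i) → ℝ)
    (hπpos : ∀ a, 0 < π a) (hπsum : ∑ a : ∀ i, A i, π a = 1)
    (a : ∀ i, A i) :
    ∑ e ∈ E, condExp π e a (fun a' => ∑ e' ∈ E, Qloc e' (restrict e' a')) =
      (∑ e ∈ E, Qloc e (restrict e a)) + bias E Qloc π a := by
  rw [bias, ← Finset.sum_add_distrib]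
  refine Finset.sum_congr rfl fun e he => ?_
  rw [condExp_sum, ← Finset.add_sum_erase E _ he, condExp_comp_restrict_self hπpos]
  congr 1
  refine Finset.sum_congr rfl fun e' _ => ?_
  exact condExp_eq_sum_condProb_mul π e a (e' \ e) _
    (fun b => Qloc e' (restrict e' (patch (e' \ e) b a)))
    fun a' h => by rw [restrict_patch_sdiff h]

end FVPOMCP
end

section
/- Suppose the components of E are pairwise disjoint and their union is I (so E partitions I), and π is a product policy: π(a) = ∏_{e∈E} π_e(a_e) for probability mass functions π_e on ∏_{i∈e} A_i, each assigning positive probability to every local action. Then the bias B_π(a) is constant in a: for every joint action a ∈ A, B_π(a) = ∑_{e∈E} ∑_{e'∈E, e'≠e} E_{π_{e'}}[Q_{e'}], where E_{π_{e'}}[Q_{e'}] = ∑_{c ∈ ∏_{i∈e'} A_i} π_{e'}(c) Q_{e'}(c). Equivalently, B_π(a) = (|E| − 1) · ∑_{e'∈E} E_{π_{e'}}[Q_{e'}]. -/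
open Finset

namespace FVPOMCP

variable {I : Type*} [Fintype I] [DecidableEq I]
variable {A : I → Type*} [∀ i, Fintype (A i)] [∀ i, DecidableEq (A i)] [∀ i, Nonempty (A i)]

section Partition

variable {I : Type*} {A : I → Type*} {E : Finset (Finset I)}

theorem restrict_patch_self [DecidableEq I] (s : Finset I) (b : ∀ i : s, A i.1) (a : ∀ i, A i) :
    restrict s (patch s b a) = b := by
  funext i
  simp [restrict, patch]

theorem restrict_patch_of_disjoint [DecidableEq I] {e s : Finset I} (h : Disjoint e s)
    (b : ∀ i : s, A i.1) (a : ∀ i, A i) : restrict e (patch s b a) = restrict e a := by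
  funext i
  simp [restrict, patch, Finset.disjoint_left.1 h i.2]

theorem restrict_bijective_of_partition [Fintype I] [DecidableEq I]
    (hpair : ∀ e ∈ E, ∀ e' ∈ E, e ≠ e' → Disjoint e e')
    (hcover : E.sup id = (Finset.univ : Finset I)) :
    Function.Bijective (fun (a : ∀ i, A i) (x : E) => restrict x.1 a) := by
  have hmem : ∀ i : I, ∃ x : E, i ∈ x.1 := fun i => by
    have hi : i ∈ E.sup id := hcover ▸ Finset.mem_univ i
    obtain ⟨x, hx, hix⟩ := Finset.mem_sup.1 hi
    exact ⟨⟨x, hx⟩, hix⟩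
  choose k hk using hmem
  refine ⟨fun a a' h => funext fun i => ?_, fun f => ⟨fun i => f (k i) ⟨i, hk i⟩, ?_⟩⟩
  · exact congrFun (congrFun h (k i)) ⟨i, hk i⟩
  · funext x i
    have hkx : k i.1 = x := by
      by_contra hne
      exact Finset.disjoint_left.1
        (hpair _ (k i.1).2 _ x.2 fun h => hne (Subtype.ext h)) (hk i.1) i.2
    have htransport : ∀ (y : E) (hy : i.1 ∈ y.1), y = x → f y ⟨i.1, hy⟩ = f x i := by
      rintro y hy rfl
      rfl
    exact htransport _ (hk i.1) hkx

variable [Fintype I] [DecidableEq I] [∀ i, Fintype (A i)]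

theorem sum_prod_restrict_of_partition
    (hpair : ∀ e ∈ E, ∀ e' ∈ E, e ≠ e' → Disjoint e e')
    (hcover : E.sup id = (Finset.univ : Finset I))
    (g : (e : Finset I) → (∀ i : e, A i.1) → ℝ) :
    ∑ a : ∀ i, A i, ∏ e ∈ E, g e (restrict e a) = ∏ e ∈ E, ∑ b : ∀ i : e, A i.1, g e b := by
  rw [← Finset.prod_coe_sort E, Fintype.prod_sum]
  refine Fintype.sum_bijective _ (restrict_bijective_of_partition hpair hcover) _ _ fun a => ?_
  exact (Finset.prod_coe_sort E fun e => g e (restrict e a)).symm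

variable [∀ i, DecidableEq (A i)]

/-- The probability under a product policy that a random joint action agrees with `c` on every
component in `T`. -/
theorem sum_ite_restrict_eq_of_product
    (hpair : ∀ e ∈ E, ∀ e' ∈ E, e ≠ e' → Disjoint e e')
    (hcover : E.sup id = (Finset.univ : Finset I))
    {π : (∀ i, A i) → ℝ} {πloc : (e : Finset I) → (∀ i : e, A i.1) → ℝ}
    (hlocsum : ∀ e ∈ E, ∑ b : ∀ i : e, A i.1, πloc e b = 1)
    (hprod : ∀ a : ∀ i, A i, π a = ∏ e ∈ E, πloc e (restrict e a))
    {T : Finset (Finset I)} (hT : T ⊆ E) (c : ∀ i, A i) :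
    (∑ a : ∀ i, A i, if ∀ x ∈ T, restrict x a = restrict x c then π a else 0) =
      ∏ x ∈ T, πloc x (restrict x c) := by
  have hsum := sum_prod_restrict_of_partition hpair hcover
    fun x b => if x ∈ T → b = restrict x c then πloc x b else 0
  rw [← Finset.prod_subset hT fun x hx hxT => by simp [hxT, hlocsum x hx]] at hsum
  calc
    _ = ∑ a : ∀ i, A i, ∏ x ∈ E,
          if x ∈ T → restrict x a = restrict x c then πloc x (restrict x a) else 0 := by
      refine Finset.sum_congr rfl fun a _ => ?_
      split_ifs with h
      · rw [hprod]
        exact Finset.prod_congr rfl fun x _ => (if_pos (h x)).symm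
      · push Not at h
        obtain ⟨x, hxT, hx⟩ := h
        exact (Finset.prod_eq_zero (hT hxT) (if_neg fun h => hx (h hxT))).symm
    _ = _ := hsum
    _ = _ := Finset.prod_congr rfl fun x hx => by simp [hx]

theorem condProb_eq_of_product
    (hpair : ∀ e ∈ E, ∀ e' ∈ E, e ≠ e' → Disjoint e e')
    (hcover : E.sup id = (Finset.univ : Finset I))
    {π : (∀ i, A i) → ℝ} {πloc : (e : Finset I) → (∀ i : e, A i.1) → ℝ}
    (hlocpos : ∀ e ∈ E, ∀ b : ∀ i : e, A i.1, 0 < πloc e b)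
    (hlocsum : ∀ e ∈ E, ∑ b : ∀ i : e, A i.1, πloc e b = 1)
    (hprod : ∀ a : ∀ i, A i, π a = ∏ e ∈ E, πloc e (restrict e a))
    {e e' : Finset I} (he : e ∈ E) (he' : e' ∈ E) (hne : e ≠ e')
    (a : ∀ i, A i) (b : ∀ i : e', A i.1) :
    condProb π e a e' b = πloc e' b := by
  have hden := sum_ite_restrict_eq_of_product hpair hcover hlocsum hprod
    (Finset.singleton_subset_iff.2 he) a
  have hnum := sum_ite_restrict_eq_of_product hpair hcover hlocsum hprod
    (Finset.insert_subset he (Finset.singleton_subset_iff.2 he')) (patch e' b a)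
  simp only [Finset.mem_singleton, forall_eq, Finset.prod_singleton] at hden
  simp only [Finset.mem_insert, Finset.mem_singleton, forall_eq_or_imp, forall_eq,
    Finset.prod_pair hne, restrict_patch_self,
    restrict_patch_of_disjoint (hpair e he e' he' hne)] at hnum
  rw [condProb, hnum, hden, mul_div_cancel_left₀ _ (hlocpos e he _).ne']

end Partition

/-- If the components of `E` partition `I` and `π` is a product
policy `π(a) = ∏_{e∈E} π_e(a_e)` with each `π_e` a positive pmf on the local actions,
then the bias is constant in `a`:
`B_π(a) = ∑_{e∈E} ∑_{e'≠e} E_{π_{e'}}[Q_{e'}] = (|E| − 1) · ∑_{e'∈E} E_{π_{e'}}[Q_{e'}]`. -/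
theorem bias_const_of_partition_product_policy
    {I : Type*} [Fintype I] [DecidableEq I]
    {A : I → Type*} [∀ i, Fintype (A i)] [∀ i, DecidableEq (A i)] [∀ i, Nonempty (A i)]
    (E : Finset (Finset I)) (Qloc : (e : Finset I) → (∀ i : e, A i.1) → ℝ)
    (π : (∀ i, A i) → ℝ)
    (πloc : (e : Finset I) → (∀ i : e, A i.1) → ℝ)
    (hpair : ∀ e ∈ E, ∀ e' ∈ E, e ≠ e' → Disjoint e e')
    (hcover : E.sup id = (Finset.univ : Finset I))
    (hlocpos : ∀ e ∈ E, ∀ b : ∀ i : e, A i.1, 0 < πloc e b)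
    (hlocsum : ∀ e ∈ E, ∑ b : ∀ i : e, A i.1, πloc e b = 1)
    (hprod : ∀ a : ∀ i, A i, π a = ∏ e ∈ E, πloc e (restrict e a))
    (a : ∀ i, A i) :
    (bias E Qloc π a =
        ∑ e ∈ E, ∑ e' ∈ E.erase e,
          ∑ c : ∀ i : e', A i.1, πloc e' c * Qloc e' c) ∧
    (bias E Qloc π a =
        ((E.card : ℝ) - 1) *
          ∑ e' ∈ E, ∑ c : ∀ i : e', A i.1, πloc e' c * Qloc e' c) := by
  have hbias : bias E Qloc π a =
      ∑ e ∈ E, ∑ e' ∈ E.erase e, ∑ c : ∀ i : e', A i.1, πloc e' c * Qloc e' c := by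
    refine Finset.sum_congr rfl fun e he => Finset.sum_congr rfl fun e' he' => ?_
    obtain ⟨hne, he'E⟩ := Finset.mem_erase.1 he'
    rw [Finset.sdiff_eq_self_of_disjoint (hpair e' he'E e he hne)]
    refine Finset.sum_congr rfl fun b _ => ?_
    rw [condProb_eq_of_product hpair hcover hlocpos hlocsum hprod he he'E hne.symm,
      restrict_patch_self]
  refine ⟨hbias, ?_⟩
  rw [hbias, Finset.sum_congr rfl fun e he => Finset.sum_erase_eq_sub he,
    Finset.sum_sub_distrib, Finset.sum_const, nsmul_eq_mul, sub_one_mul]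

end FVPOMCP
end

section
/- Suppose π is component-wise: for all e, e' ∈ E, all local actions a_e, and all b̄ ∈ ∏_{i∈e'∖e} A_i, π(b̄ | a_e) = π(b̄), the marginal π-probability that a random joint action restricts to b̄ on e'∖e (independent of a_e). Suppose further that ε > 0 and the ε-condition holds: for all e ∈ E, e' ∈ N(e), all b̄ ∈ ∏_{i∈e'∖e} A_i, and all c, c' ∈ ∏_{i∈e'∩e} A_i, Q_{e'}(b̄, c) − Q_{e'}(b̄, c') ≤ ε / (|E| · |N(e)| · |A_{e'∖e}| · π(b̄)). Then the bias differences are uniformly bounded: for all joint actions a, a' ∈ A, B_π(a) − B_π(a') ≤ ε. -/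
open Finset

namespace FVPOMCP

variable {I : Type*} [Fintype I] [DecidableEq I]
variable {A : I → Type*} [∀ i, Fintype (A i)] [∀ i, DecidableEq (A i)] [∀ i, Nonempty (A i)]

/-- The local action for `e'` agreeing with `b` on `e' ∖ e` and with `c` on `e' ∩ e`. -/
def combine (e' e : Finset I) (b : ∀ i : (e' \ e : Finset I), A i.1)
    (c : ∀ i : (e' ∩ e : Finset I), A i.1) : ∀ i : e', A i.1 :=
  fun i =>
    if h : i.1 ∈ e then c ⟨i.1, Finset.mem_inter.2 ⟨i.2, h⟩⟩
    else b ⟨i.1, Finset.mem_sdiff.2 ⟨i.2, h⟩⟩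

/-- The neighborhood `N(e)`: the components `e' ≠ e` that overlap with `e`. -/
def neighborhood (E : Finset (Finset I)) (e : Finset I) : Finset (Finset I) :=
  (E.erase e).filter fun e' => (e' ∩ e).Nonempty

theorem restrict_patch_sdiff_s6 {I : Type*} [DecidableEq I] {A : I → Type*}
    (e' e : Finset I) (b : ∀ i : (e' \ e : Finset I), A i.1) (a : ∀ i, A i) :
    restrict e' (patch (e' \ e) b a) = combine e' e b (restrict (e' ∩ e) a) := by
  funext i
  by_cases h : i.1 ∈ e <;> simp [restrict, patch, combine, h]

theorem margProb_pos {π : (∀ i, A i) → ℝ} (hπ : ∀ a, 0 < π a) (s : Finset I)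
    (b : ∀ i : s, A i.1) : 0 < margProb π s b := by
  let a₀ : ∀ i, A i := patch s b fun _ => Classical.arbitrary _
  refine Finset.sum_pos' (fun a _ => ?_) ⟨a₀, Finset.mem_univ _, ?_⟩
  · split_ifs
    exacts [(hπ a).le, le_rfl]
  · have h : restrict s a₀ = b := by
      funext i
      simp [a₀, restrict, patch]
    rw [if_pos h]
    exact hπ a₀

theorem sum_le_of_le_div_card {ι : Type*} (s : Finset ι) (f : ι → ℝ) {x : ℝ}
    (hx : 0 ≤ x) (hf : ∀ i ∈ s, f i ≤ x / (s.card : ℝ)) : ∑ i ∈ s, f i ≤ x := by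
  calc ∑ i ∈ s, f i ≤ s.card • (x / (s.card : ℝ)) := Finset.sum_le_card_nsmul _ _ _ hf
    _ = (s.card : ℝ) * x / (s.card : ℝ) := by rw [nsmul_eq_mul, mul_div_assoc]
    _ ≤ x := div_le_of_le_mul₀ (Nat.cast_nonneg _) hx (mul_comm _ _).le

/-- If `π` is component-wise (`π(b̄ | a_e) = π(b̄)` for all components
`e, e' ∈ E`, local actions `a_e`, and `b̄` on `e' ∖ e`) and the `ε`-condition holds
(`Q_{e'}(b̄, c) − Q_{e'}(b̄, c') ≤ ε / (|E| · |N(e)| · |A_{e'∖e}| · π(b̄))` for all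
`e ∈ E`, `e' ∈ N(e)`, `b̄`, and intersection action profiles `c, c'`), then the bias
differences are uniformly bounded: `B_π(a) − B_π(a') ≤ ε` for all joint actions `a, a'`. -/
theorem bias_diff_le_of_componentwise_policy
    {I : Type*} [Fintype I] [DecidableEq I]
    {A : I → Type*} [∀ i, Fintype (A i)] [∀ i, DecidableEq (A i)] [∀ i, Nonempty (A i)]
    (E : Finset (Finset I)) (Qloc : (e : Finset I) → (∀ i : e, A i.1) → ℝ)
    (π : (∀ i, A i) → ℝ)
    (hπpos : ∀ a, 0 < π a) (hπsum : ∑ a : ∀ i, A i, π a = 1)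
    (hcw : ∀ e ∈ E, ∀ e' ∈ E, ∀ (a : ∀ i, A i) (b : ∀ i : (e' \ e : Finset I), A i.1),
      condProb π e a (e' \ e) b = margProb π (e' \ e) b)
    (ε : ℝ) (hε : 0 < ε)
    (hcond : ∀ e ∈ E, ∀ e' ∈ neighborhood E e,
      ∀ (b : ∀ i : (e' \ e : Finset I), A i.1) (c c' : ∀ i : (e' ∩ e : Finset I), A i.1),
        Qloc e' (combine e' e b c) - Qloc e' (combine e' e b c') ≤
          ε / ((E.card : ℝ) * ((neighborhood E e).card : ℝ) *
            (Fintype.card (∀ i : (e' \ e : Finset I), A i.1) : ℝ) * margProb π (e' \ e) b))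
    (a a' : ∀ i, A i) :
    bias E Qloc π a - bias E Qloc π a' ≤ ε := by
  simp only [bias, restrict_patch_sdiff_s6, ← Finset.sum_sub_distrib]
  refine sum_le_of_le_div_card E _ hε.le fun e he => ?_
  have hE : 0 ≤ ε / (E.card : ℝ) := by positivity
  rw [← Finset.sum_subset (Finset.filter_subset (fun e' => (e' ∩ e).Nonempty) (E.erase e))]
  · refine sum_le_of_le_div_card (neighborhood E e) _ hE fun e' he' => ?_
    have hmem : e' ∈ E := Finset.mem_of_mem_erase (Finset.mem_filter.1 he').1
    refine sum_le_of_le_div_card _ _ (by positivity) fun b _ => ?_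
    have hpos := margProb_pos hπpos (e' \ e) b
    rw [hcw e he e' hmem, hcw e he e' hmem, ← mul_sub]
    refine (mul_le_mul_of_nonneg_left (hcond e he e' he' b _ _) hpos.le).trans_eq ?_
    rw [Finset.card_univ, div_div, div_div, ← div_div _ _ (margProb π (e' \ e) b),
      mul_div_cancel₀ _ hpos.ne', mul_assoc]
  · intro e' he' hdisj
    have hmem : e' ∈ E := Finset.mem_of_mem_erase he'
    have hempty : e' ∩ e = ∅ := by
      simpa [he', Finset.not_nonempty_iff_eq_empty] using hdisj
    have hrestrict : restrict (e' ∩ e) a = restrict (e' ∩ e) a' := by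
      funext i
      exact absurd i.2 (by simp [hempty])
    refine Finset.sum_eq_zero fun b _ => ?_
    rw [hcw e he e' hmem, hcw e he e' hmem, hrestrict, sub_self]

end FVPOMCP
end
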